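/- Let Ω ⊂ ℝⁿ be a bounded domain with a tree-covering {U_t}_{t∈Γ} obtained from a Whitney decomposition (U_t = (17/16)·int(Q_t)). Let p(·) be an exponent function with 1 < p_- ≤ p_+ < ∞ and p(·) ∈ ∂LH_0^τ(Ω) for some τ ≥ 1. For each t ∈ Γ define the harmonic average p_{U_t} by 1/p_{U_t} = |U_t|^{-1} ∫_{U_t} (1/p(x)) dx. Then there are constants c, C > 0, independent of t, such that c |U_t|^{1/p_{U_t}} ≤ ‖χ_{U_t}‖_{L^{p(·)}(Ω)} ≤ C |U_t|^{1/p_{U_t}} for every t ∈ Γ. -/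

import Mathlib

open MeasureTheory Metric Set Filter Topology

noncomputable section

abbrev Eucl (n : ℕ) : Type := EuclideanSpace ℝ (Fin n)

/-- Essential supremum of `p` over the set `A` (w.r.t. Lebesgue measure). -/
def essSupOn {n : ℕ} (p : Eucl n → ℝ) (A : Set (Eucl n)) : ℝ :=
  essSup p (volume.restrict A)

/-- Essential infimum of `p` over the set `A` (w.r.t. Lebesgue measure). -/
def essInfOn {n : ℕ} (p : Eucl n → ℝ) (A : Set (Eucl n)) : ℝ :=
  essInf p (volume.restrict A)

/-- The Luxemburg norm of `f` on `A` with variable exponent `p`. -/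
def luxNorm {n : ℕ} (A : Set (Eucl n)) (p f : Eucl n → ℝ) : ℝ :=
  sInf {l : ℝ | 0 < l ∧ (∫⁻ x in A, ENNReal.ofReal ((|f x| / l) ^ (p x))) ≤ 1}

/-- `f` belongs to the variable Lebesgue space `L^{p(·)}(A)`. -/
def MemVarLp {n : ℕ} (A : Set (Eucl n)) (p f : Eucl n → ℝ) : Prop :=
  ∃ l : ℝ, 0 < l ∧ (∫⁻ x in A, ENNReal.ofReal ((|f x| / l) ^ (p x))) ≤ 1

/-- `d(x) = dist(x, ∂Ω)`. -/
def bdist {n : ℕ} (Ω : Set (Eucl n)) (x : Eucl n) : ℝ :=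
  infDist x (frontier Ω)

/-- The ball `B_{x,τ} = B(x, τ d(x))`. -/
def ballB {n : ℕ} (Ω : Set (Eucl n)) (τ : ℝ) (x : Eucl n) : Set (Eucl n) :=
  ball x (τ * bdist Ω x)

/-- The boundary log-Hölder condition `∂LH₀^τ(Ω)` with constant `C₀`. -/
def BoundaryLH {n : ℕ} (Ω : Set (Eucl n)) (p : Eucl n → ℝ) (τ C₀ : ℝ) : Prop :=
  ∀ x ∈ Ω, τ * bdist Ω x ≤ 1 / 2 →
    essSupOn p (ballB Ω τ x ∩ Ω) - essInfOn p (ballB Ω τ x ∩ Ω)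
      ≤ C₀ / (-Real.log (τ * bdist Ω x))

/-- `Ω` is a John domain with parameter `lam`. -/
def JohnDomain {n : ℕ} (Ω : Set (Eucl n)) (lam : ℝ) : Prop :=
  ∃ x₀ ∈ Ω, ∀ y ∈ Ω, ∃ ℓ : ℝ, 0 ≤ ℓ ∧ ∃ γ : ℝ → Eucl n,
    γ 0 = y ∧ γ ℓ = x₀ ∧ (∀ t ∈ Icc (0:ℝ) ℓ, γ t ∈ Ω) ∧
    LipschitzOnWith 1 γ (Icc (0:ℝ) ℓ) ∧
    ∀ t ∈ Icc (0:ℝ) ℓ, t ≤ lam * infDist (γ t) (frontier Ω)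

/-- `g` is uniformly `ε`-continuous on `S`. -/
def UnifEpsCont {n : ℕ} (S : Set (Eucl n)) (g : Eucl n → ℝ) (ε : ℝ) : Prop :=
  ∃ δ : ℝ, 0 < δ ∧ ∀ x ∈ S, ∀ y ∈ S, dist x y < δ → |g y - g x| < ε

/-- `f` is locally Lipschitz on `S`. -/
def LocLipschitzOn {n : ℕ} (S : Set (Eucl n)) (f : Eucl n → ℝ) : Prop :=
  ∀ x ∈ S, ∃ K : NNReal, ∃ t ∈ 𝓝 x, LipschitzOnWith K f (t ∩ S)

/-- The average of `f` over `A`. -/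
def avgOn {n : ℕ} (A : Set (Eucl n)) (f : Eucl n → ℝ) : ℝ :=
  (volume A).toReal⁻¹ * ∫ x in A, f x

/-- The pointwise dual (conjugate) exponent `p'`, `1/p + 1/p' = 1`. -/
def dualExp {α : Type*} (p : α → ℝ) : α → ℝ :=
  fun x => p x / (p x - 1)

/-- The norm of the a.e.-defined gradient of `f`. -/
def gradNorm {n : ℕ} (f : Eucl n → ℝ) : Eucl n → ℝ :=
  fun x => ‖fderiv ℝ f x‖

/-- The closed dyadic cube of generation `k` with lattice coordinates `z`. -/
def cubeQ {n : ℕ} (k : ℤ) (z : Fin n → ℤ) : Set (Eucl n) :=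
  {x | ∀ i, |x i - ((z i : ℝ) + 1 / 2) * (2:ℝ) ^ (-k)| ≤ (2:ℝ) ^ (-k) / 2}

/-- The expanded open cube `U = (17/16)·int(Q)`. -/
def cubeU {n : ℕ} (k : ℤ) (z : Fin n → ℤ) : Set (Eucl n) :=
  {x | ∀ i, |x i - ((z i : ℝ) + 1 / 2) * (2:ℝ) ^ (-k)| < (17 / 16) * ((2:ℝ) ^ (-k) / 2)}

/-- The dilation `K·Q` of the cube `Q` about its center. -/
def cubeDil {n : ℕ} (K : ℝ) (k : ℤ) (z : Fin n → ℤ) : Set (Eucl n) :=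
  {x | ∀ i, |x i - ((z i : ℝ) + 1 / 2) * (2:ℝ) ^ (-k)| ≤ K * ((2:ℝ) ^ (-k) / 2)}

/-- Distance between two sets. -/
def setDist {n : ℕ} (A B : Set (Eucl n)) : ℝ :=
  sInf (Set.image2 dist A B)

/-- A tree-covering of a bounded domain `Ω` obtained from a Whitney decomposition,
with `U_t = (17/16)·int(Q_t)` (Remark 3.2). -/
structure WhitneyTreeCovering (n : ℕ) (Ω : Set (Eucl n)) where
  ι : Type
  countable : Countable ι
  kk : ι → ℤ
  zz : ι → Fin n → ℤ
  disjQ : ∀ s t : ι, s ≠ t →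
    Disjoint (interior (cubeQ (kk s) (zz s))) (interior (cubeQ (kk t) (zz t)))
  unionQ : (⋃ t : ι, cubeQ (kk t) (zz t)) = Ω
  whitney₁ : ∀ t, Metric.diam (cubeQ (kk t) (zz t))
    ≤ setDist (cubeQ (kk t) (zz t)) (frontier Ω)
  whitney₂ : ∀ t, setDist (cubeQ (kk t) (zz t)) (frontier Ω)
    ≤ 4 * Metric.diam (cubeQ (kk t) (zz t))
  neighbor : ∀ s t : ι, (cubeQ (kk s) (zz s) ∩ cubeQ (kk t) (zz t)).Nonempty →
    Metric.diam (cubeQ (kk t) (zz t)) ≤ 4 * Metric.diam (cubeQ (kk s) (zz s))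
  root : ι
  parent : ι → ι
  parent_root : parent root = root
  reach : ∀ t : ι, ∃ m : ℕ, parent^[m] t = root
  C₁ : ℝ
  one_le_C₁ : 1 ≤ C₁
  cover : ∀ᵐ x ∂(volume : Measure (Eucl n)),
    (x ∈ Ω → 1 ≤ ∑' t : ι, Set.indicator (cubeU (kk t) (zz t)) (fun _ => (1:ℝ)) x) ∧
    (∑' t : ι, Set.indicator (cubeU (kk t) (zz t)) (fun _ => (1:ℝ)) x
      ≤ C₁ * Set.indicator Ω (fun _ => (1:ℝ)) x)
  Bt : ι → Set (Eucl n)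
  Bt_open : ∀ t, IsOpen (Bt t)
  Bt_sub : ∀ t, t ≠ root → Bt t ⊆ cubeU (kk t) (zz t) ∩ cubeU (kk (parent t)) (zz (parent t))
  Bt_disj : ∀ s t, s ≠ root → t ≠ root → s ≠ t → Disjoint (Bt s) (Bt t)
  C₂ : ℝ
  meas_ratio : ∀ t, t ≠ root →
    (volume (cubeU (kk t) (zz t))).toReal ≤ C₂ * (volume (Bt t)).toReal

/-- The Whitney cube `Q_t`. -/
def WhitneyTreeCovering.Q {n : ℕ} {Ω : Set (Eucl n)} (T : WhitneyTreeCovering n Ω)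
    (t : T.ι) : Set (Eucl n) := cubeQ (T.kk t) (T.zz t)

/-- The expanded cube `U_t`. -/
def WhitneyTreeCovering.U {n : ℕ} {Ω : Set (Eucl n)} (T : WhitneyTreeCovering n Ω)
    (t : T.ι) : Set (Eucl n) := cubeU (T.kk t) (T.zz t)

/-- The shadow `W_t = ⋃_{s ⪰ t} U_s`. -/
def WhitneyTreeCovering.shadow {n : ℕ} {Ω : Set (Eucl n)} (T : WhitneyTreeCovering n Ω)
    (t : T.ι) : Set (Eucl n) :=
  ⋃ s ∈ {s : T.ι | ∃ m : ℕ, T.parent^[m] s = t}, T.U s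

/-- The characteristic function of a set, as a real valued function. -/
def charFun {n : ℕ} (A : Set (Eucl n)) : Eucl n → ℝ :=
  Set.indicator A (fun _ => (1:ℝ))

/-- If `1 / p` deviates from `q` by at most `L / |log |U||` on `U`, then
`‖χ_U‖_{p(·)}` is comparable to `|U| ^ q` with constant `exp L`. -/
lemma luxNorm_charFun_bounds {n : ℕ} {A U : Set (Eucl n)} {p : Eucl n → ℝ} {q L : ℝ}
    (hA : MeasurableSet A) (hU : MeasurableSet U) (hUA : U ⊆ A)
    (hp : ∀ x ∈ A, 1 ≤ p x) (hV : 0 < (volume U).toReal)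
    (hq : ∀ᵐ x ∂(volume.restrict U), |1 / p x - q| * |Real.log (volume U).toReal| ≤ L) :
    Real.exp (-L) * (volume U).toReal ^ q ≤ luxNorm A p (charFun U) ∧
      luxNorm A p (charFun U) ≤ Real.exp L * (volume U).toReal ^ q := by
  have hVtop : volume U ≠ ⊤ := fun h => by simp [h] at hV
  set V := (volume U).toReal with hVdef
  set v := Real.log V with hvdef
  have hVexp : V = Real.exp v := (Real.exp_log hV).symm
  have hVq : V ^ q = Real.exp (v * q) := by rw [Real.rpow_def_of_pos hV]
  have hvol : volume U = ENNReal.ofReal (Real.exp v) := by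
    rw [← hVexp, hVdef, ENNReal.ofReal_toReal hVtop]
  have hint : ∀ s : ℝ, ∫⁻ x in A, ENNReal.ofReal ((|charFun U x| / Real.exp s) ^ (p x))
      = ∫⁻ x in U, ENNReal.ofReal (Real.exp (-(p x * s))) := by
    intro s
    have h1 : ∫⁻ x in A, ENNReal.ofReal ((|charFun U x| / Real.exp s) ^ (p x))
        = ∫⁻ x in A, U.indicator (fun x => ENNReal.ofReal (Real.exp (-(p x * s)))) x := by
      refine setLIntegral_congr_fun hA fun x hx => ?_
      by_cases hxU : x ∈ U
      · simp only [_root_.charFun, indicator_of_mem hxU, abs_one]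
        rw [one_div, ← Real.exp_neg, ← Real.exp_mul]
        congr 2; ring
      · have : p x ≠ 0 := by linarith [hp x hx]
        simp [_root_.charFun, indicator_of_notMem hxU, Real.zero_rpow this]
    rw [h1, setLIntegral_indicator hU, inter_eq_self_of_subset_left hUA]
  have hpU : ∀ᵐ x ∂(volume.restrict U), 1 ≤ p x :=
    (ae_restrict_iff' hU).2 (Eventually.of_forall fun x hx => hp x (hUA hx))
  have hdev : ∀ᵐ x ∂(volume.restrict U), 1 ≤ p x ∧ |v - p x * (v * q)| ≤ p x * L := by
    filter_upwards [hq, hpU] with x hx h1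
    refine ⟨h1, ?_⟩
    have hpx : 0 < p x := by linarith
    rw [← abs_mul] at hx
    have : v - p x * (v * q) = p x * ((1 / p x - q) * v) := by field_simp
    rw [this, abs_mul, abs_of_pos hpx]
    exact mul_le_mul_of_nonneg_left hx hpx.le
  have hmem : Real.exp (L + v * q) ∈ {l : ℝ | 0 < l ∧
      (∫⁻ x in A, ENNReal.ofReal ((|charFun U x| / l) ^ (p x))) ≤ 1} := by
    refine ⟨Real.exp_pos _, ?_⟩
    rw [hint]
    calc ∫⁻ x in U, ENNReal.ofReal (Real.exp (-(p x * (L + v * q))))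
        ≤ ∫⁻ _ in U, ENNReal.ofReal (Real.exp (-v)) := by
          refine lintegral_mono_ae ?_
          filter_upwards [hdev] with x hx
          refine ENNReal.ofReal_le_ofReal (Real.exp_le_exp.2 ?_)
          have := (abs_le.1 hx.2).2
          nlinarith
      _ = 1 := by
          rw [setLIntegral_const, hvol, ← ENNReal.ofReal_mul (Real.exp_pos _).le, ← Real.exp_add]
          simp
  rw [hVq, ← Real.exp_add, ← Real.exp_add]
  refine ⟨le_csInf ⟨_, hmem⟩ ?_, csInf_le ⟨0, fun l hl => hl.1.le⟩ hmem⟩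
  rintro l ⟨hl, hl1⟩
  by_contra! hlt
  obtain ⟨s, rfl⟩ : ∃ s, l = Real.exp s := ⟨Real.log l, (Real.exp_log hl).symm⟩
  have hs := Real.exp_lt_exp.1 hlt
  rw [hint] at hl1
  have hgt : (1 : ENNReal) < ∫⁻ x in U, ENNReal.ofReal (Real.exp (-(p x * s))) := by
    calc (1 : ENNReal) < ENNReal.ofReal (Real.exp (-L + v * q - s)) := by
          rw [← ENNReal.ofReal_one, ENNReal.ofReal_lt_ofReal_iff (Real.exp_pos _)]
          exact Real.one_lt_exp_iff.2 (by linarith)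
      _ = ∫⁻ _ in U, ENNReal.ofReal (Real.exp (-v + (-L + v * q - s))) := by
          rw [setLIntegral_const, hvol, ← ENNReal.ofReal_mul (Real.exp_pos _).le, ← Real.exp_add]
          congr 2; ring
      _ ≤ _ := by
          refine lintegral_mono_ae ?_
          filter_upwards [hdev] with x hx
          refine ENNReal.ofReal_le_ofReal (Real.exp_le_exp.2 ?_)
          have h1 := (abs_le.1 hx.2).1
          have h2 := mul_le_mul_of_nonneg_right hx.1 (by linarith : 0 ≤ -L + v * q - s)
          nlinarith
  exact absurd hl1 hgt.not_ge

/-- A function deviates from its average by at most the length of an interval containing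
almost all of its values. -/
lemma ae_abs_sub_avg_le {n : ℕ} {U : Set (Eucl n)} {f : Eucl n → ℝ} {a b : ℝ}
    (hf : Measurable f) (hV : 0 < (volume U).toReal)
    (hab : ∀ᵐ x ∂(volume.restrict U), a ≤ f x ∧ f x ≤ b) :
    ∀ᵐ x ∂(volume.restrict U), |f x - (volume U).toReal⁻¹ * ∫ x in U, f x| ≤ b - a := by
  have hVtop : volume U ≠ ⊤ := fun h => by simp [h] at hV
  have : IsFiniteMeasure (volume.restrict U) := ⟨by simpa using hVtop.lt_top⟩
  have hfi : Integrable f (volume.restrict U) := by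
    refine Integrable.of_bound hf.aestronglyMeasurable (max |a| |b|) ?_
    filter_upwards [hab] with x hx
    exact abs_le_max_abs_abs hx.1 hx.2
  have hconst : ∀ c : ℝ, ∫ _ in U, c = (volume U).toReal * c := fun c => by
    simp [measureReal_def]
  have h1 : (volume U).toReal * a ≤ ∫ x in U, f x := by
    rw [← hconst]
    exact integral_mono_ae (integrable_const _) hfi (hab.mono fun x hx => hx.1)
  have h2 : ∫ x in U, f x ≤ (volume U).toReal * b := by
    rw [← hconst]
    exact integral_mono_ae hfi (integrable_const _) (hab.mono fun x hx => hx.2)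
  have h3 : a ≤ (volume U).toReal⁻¹ * ∫ x in U, f x := (le_inv_mul_iff₀ hV).2 h1
  have h4 : (volume U).toReal⁻¹ * ∫ x in U, f x ≤ b := (inv_mul_le_iff₀ hV).2 h2
  filter_upwards [hab] with x hx
  rw [abs_le]
  constructor <;> linarith [hx.1, hx.2]

lemma dist_le_sqrt_mul {n : ℕ} {x y : Eucl n} {r : ℝ} (hr : 0 ≤ r)
    (h : ∀ i, |x i - y i| ≤ r) : dist x y ≤ √n * r := by
  rw [EuclideanSpace.dist_eq]
  calc √(∑ i, dist (x i) (y i) ^ 2) ≤ √(∑ _i : Fin n, r ^ 2) := by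
        refine Real.sqrt_le_sqrt (Finset.sum_le_sum fun i _ => ?_)
        rw [Real.dist_eq]
        exact pow_le_pow_left₀ (abs_nonneg _) (h i) 2
    _ = √n * r := by
        simp [Real.sqrt_sq hr]

/-- The center of a dyadic cube. -/
def cubeCenter {n : ℕ} (k : ℤ) (z : Fin n → ℤ) : Eucl n :=
  WithLp.toLp 2 fun i => ((z i : ℝ) + 1 / 2) * (2:ℝ) ^ (-k)

lemma cubeCenter_mem {n : ℕ} (k : ℤ) (z : Fin n → ℤ) : cubeCenter k z ∈ cubeQ k z := by
  intro i
  simp only [cubeCenter, sub_self, abs_zero]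
  positivity

lemma dist_le_of_mem_cubeQ {n : ℕ} {k : ℤ} {z : Fin n → ℤ} {x y : Eucl n}
    (hx : x ∈ cubeQ k z) (hy : y ∈ cubeQ k z) : dist x y ≤ √n * (2:ℝ) ^ (-k) := by
  refine dist_le_sqrt_mul (by positivity) fun i => ?_
  have h1 := abs_le.1 (hx i)
  have h2 := abs_le.1 (hy i)
  rw [abs_le]
  constructor <;> linarith [h1.1, h1.2, h2.1, h2.2]

lemma diam_cubeQ {n : ℕ} (k : ℤ) (z : Fin n → ℤ) :
    diam (cubeQ k z) = √n * (2:ℝ) ^ (-k) := by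
  refine le_antisymm (diam_le_of_forall_dist_le (by positivity)
    fun x hx y hy => dist_le_of_mem_cubeQ hx hy) ?_
  have hl : (0:ℝ) < (2:ℝ) ^ (-k) := by positivity
  set x : Eucl n := WithLp.toLp 2 fun i => ((z i : ℝ) + 1) * (2:ℝ) ^ (-k) with hx
  set y : Eucl n := WithLp.toLp 2 fun i => (z i : ℝ) * (2:ℝ) ^ (-k) with hy
  have hxQ : x ∈ cubeQ k z := fun i => by
    simp only [hx]; rw [abs_le]; constructor <;> nlinarith
  have hyQ : y ∈ cubeQ k z := fun i => by
    simp only [hy]; rw [abs_le]; constructor <;> nlinarith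
  have hdist : dist x y = √n * (2:ℝ) ^ (-k) := by
    rw [EuclideanSpace.dist_eq]
    have : ∀ i, dist (x i) (y i) = (2:ℝ) ^ (-k) := fun i => by
      simp only [hx, hy, Real.dist_eq]
      rw [← abs_of_pos hl]; congr 1; rw [abs_of_pos hl]; ring
    simp only [this]
    simp [Real.sqrt_sq hl.le, -zpow_neg]
  rw [← hdist]
  refine dist_le_diam_of_mem ?_ hxQ hyQ
  exact isBounded_iff.2 ⟨_, fun a ha b hb => dist_le_of_mem_cubeQ ha hb⟩

lemma volume_cubeU {n : ℕ} (k : ℤ) (z : Fin n → ℤ) :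
    volume (cubeU k z) = ENNReal.ofReal ((17 / 16 * (2:ℝ) ^ (-k)) ^ n) := by
  have hl : (0:ℝ) < (2:ℝ) ^ (-k) := by positivity
  have h : cubeU k z = (WithLp.ofLp : Eucl n → (Fin n → ℝ)) ⁻¹' (Set.pi univ fun i =>
      ball (((z i : ℝ) + 1 / 2) * (2:ℝ) ^ (-k)) ((17 / 16) * ((2:ℝ) ^ (-k) / 2))) := by
    ext x
    simp only [cubeU, mem_ofPred_eq, mem_preimage, mem_univ_pi, mem_ball, Real.dist_eq]
  rw [h, (PiLp.volume_preserving_ofLp (Fin n)).measure_preimage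
    (MeasurableSet.univ_pi fun i => measurableSet_ball).nullMeasurableSet, volume_pi_pi]
  simp only [Real.volume_ball, Finset.prod_const, Finset.card_univ, Fintype.card_fin]
  rw [ENNReal.ofReal_pow (by positivity)]
  congr 2; ring

lemma measurableSet_cubeU {n : ℕ} (k : ℤ) (z : Fin n → ℤ) : MeasurableSet (cubeU k z) := by
  simp only [cubeU, ofPred_forall]
  exact MeasurableSet.iInter fun i => measurableSet_lt (by fun_prop) measurable_const

/-- An open set contains the ball around each of its points that reaches to the boundary. -/
lemma ball_infDist_frontier_subset {n : ℕ} {Ω : Set (Eucl n)} (hΩ : IsOpen Ω) {x : Eucl n}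
    (hx : x ∈ Ω) : ball x (infDist x (frontier Ω)) ⊆ Ω := by
  intro y hy
  have hpos : 0 < infDist x (frontier Ω) := pos_of_mem_ball hy
  have hdisj : ∀ w ∈ ball x (infDist x (frontier Ω)), w ∉ frontier Ω := fun w hw hwf => by
    have := infDist_le_dist_of_mem (x := x) hwf
    rw [mem_ball, dist_comm] at hw
    linarith
  refine (convex_ball _ _).isPreconnected.subset_left_of_subset_union hΩ
    (isClosed_closure (s := Ω)).isOpen_compl ?_ ?_ ⟨x, mem_ball_self hpos, hx⟩ hy
  · exact disjoint_compl_right_iff_subset.2 subset_closure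
  · intro w hw
    by_cases hwΩ : w ∈ Ω
    · exact Or.inl hwΩ
    · exact Or.inr fun hc => hdisj w hw ⟨hc, by rwa [hΩ.interior_eq]⟩

/-- A bounded exponent lies almost everywhere between its essential bounds. -/
lemma ae_mem_Icc_essInfOn_essSupOn {n : ℕ} {A : Set (Eucl n)} {p : Eucl n → ℝ} {m M : ℝ}
    (h : ∀ᵐ x ∂(volume.restrict A), m ≤ p x ∧ p x ≤ M) :
    ∀ᵐ x ∂(volume.restrict A), essInfOn p A ≤ p x ∧ p x ≤ essSupOn p A := by
  have h1 : ∀ᵐ x ∂(volume.restrict A), p x ≤ essSupOn p A :=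
    ae_le_essSup ⟨M, by simpa using h.mono fun x hx => hx.2⟩
  have h2 : ∀ᵐ x ∂(volume.restrict A), essInfOn p A ≤ p x :=
    ae_essInf_le ⟨m, by simpa using h.mono fun x hx => hx.1⟩
  exact h2.and h1

lemma abs_log_le_of_mem_Icc {a b x : ℝ} (ha : 0 < a) (hax : a ≤ x) (hxb : x ≤ b) :
    |Real.log x| ≤ max |Real.log a| |Real.log b| :=
  abs_le_max_abs_abs (Real.log_le_log ha hax) (Real.log_le_log (ha.trans_le hax) hxb)

/-- In positive dimension, a bounded nonempty set has nonempty frontier. -/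
lemma frontier_nonempty_of_isBounded {n : ℕ} (hn : 0 < n) {Ω : Set (Eucl n)}
    (hne : Ω.Nonempty) (hb : Bornology.IsBounded Ω) : (frontier Ω).Nonempty := by
  have : Nonempty (Fin n) := ⟨⟨0, hn⟩⟩
  refine nonempty_frontier_iff.2 ⟨hne, fun h => ?_⟩
  rw [h] at hb
  exact NormedSpace.unbounded_univ ℝ (Eucl n) hb

/-- For a small cube of side `ℓ` at distance comparable to `d` from the boundary, the logarithm
of the volume of its dilation is controlled by `-log (τ d)`. -/
lemma abs_log_pow_le_neg_log {τ d ℓ : ℝ} {n : ℕ} (hn : 0 < n) (hτ : 1 ≤ τ) (hd : 0 < d) (hℓ : 0 < ℓ)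
    (hdℓ : d ≤ 5 * (√n * ℓ)) (hsmall : ℓ ≤ 1 / (4 * (5 * τ * √n) ^ 2)) :
    τ * d ≤ 1 / 2 ∧ |Real.log ((17 / 16 * ℓ) ^ n)| ≤ 2 * n * -Real.log (τ * d) := by
  have hsn : 1 ≤ √(n:ℝ) := Real.one_le_sqrt.2 (by exact_mod_cast hn)
  set A := 5 * τ * √n with hA
  have hA1 : 1 ≤ A := by nlinarith [mul_le_mul hτ hsn (by norm_num) (by linarith)]
  have hle : ℓ * (4 * A ^ 2) ≤ 1 := (le_div_iff₀ (by positivity)).1 hsmall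
  have hτd : τ * d ≤ A * ℓ := by
    have := mul_le_mul_of_nonneg_left hdℓ (by linarith : 0 ≤ τ)
    rw [hA]; linarith
  have hsq : (τ * d) ^ 2 ≤ ℓ := by
    have h1 : (τ * d) ^ 2 ≤ (A * ℓ) ^ 2 := pow_le_pow_left₀ (by positivity) hτd 2
    have h2 : (A * ℓ) ^ 2 = (ℓ * (4 * A ^ 2)) * ℓ / 4 := by ring
    nlinarith
  have hA2 : 1 ≤ A ^ 2 := one_le_pow₀ hA1
  have hℓ4 : ℓ ≤ 1 / 4 := by nlinarith
  refine ⟨by nlinarith [mul_pos (by linarith : (0:ℝ) < τ) hd], ?_⟩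
  have hlog1 : 2 * Real.log (τ * d) ≤ Real.log ℓ := by
    have h := Real.log_le_log (by positivity) hsq
    rw [Real.log_pow] at h
    exact_mod_cast h
  have hlog2 : Real.log ℓ ≤ Real.log (17 / 16 * ℓ) := Real.log_le_log hℓ (by linarith)
  have hlog3 : Real.log (17 / 16 * ℓ) ≤ 0 := Real.log_nonpos (by positivity) (by linarith)
  have hn0 : (0:ℝ) ≤ n := n.cast_nonneg
  rw [Real.log_pow, abs_of_nonpos (mul_nonpos_of_nonneg_of_nonpos hn0 hlog3)]
  nlinarith

namespace WhitneyTreeCovering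

variable {n : ℕ} {Ω : Set (Eucl n)} (T : WhitneyTreeCovering n Ω)

/-- The side length of the Whitney cube `Q_t`. -/
def side (t : T.ι) : ℝ := (2:ℝ) ^ (-T.kk t)

/-- The center of the Whitney cube `Q_t`. -/
def center (t : T.ι) : Eucl n := cubeCenter (T.kk t) (T.zz t)

lemma side_pos (t : T.ι) : 0 < T.side t := by
  unfold side; positivity

lemma center_mem (t : T.ι) : T.center t ∈ Ω :=
  T.unionQ.subset (mem_iUnion.2 ⟨t, cubeCenter_mem _ _⟩)

lemma toReal_volume_U (t : T.ι) : (volume (T.U t)).toReal = (17 / 16 * T.side t) ^ n := by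
  have := T.side_pos t
  rw [U, volume_cubeU, ENNReal.toReal_ofReal (by positivity), side]

lemma le_bdist_center (hf : (frontier Ω).Nonempty) (t : T.ι) :
    √n * T.side t ≤ bdist Ω (T.center t) := by
  rw [bdist, le_infDist hf]
  intro y hy
  rw [side, ← diam_cubeQ (T.kk t) (T.zz t)]
  refine (T.whitney₁ t).trans (csInf_le ⟨0, ?_⟩ ⟨_, cubeCenter_mem _ _, y, hy, rfl⟩)
  rintro _ ⟨a, _, b, _, rfl⟩
  exact dist_nonneg

lemma bdist_center_le (hf : (frontier Ω).Nonempty) (t : T.ι) :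
    bdist Ω (T.center t) ≤ 5 * (√n * T.side t) := by
  have h1 : bdist Ω (T.center t) - √n * T.side t
      ≤ setDist (cubeQ (T.kk t) (T.zz t)) (frontier Ω) := by
    refine le_csInf (Set.Nonempty.image2 ⟨_, cubeCenter_mem _ _⟩ hf) ?_
    rintro _ ⟨a, ha, b, hb, rfl⟩
    have h2 : bdist Ω (T.center t) ≤ dist (T.center t) b := infDist_le_dist_of_mem hb
    have h3 : dist (T.center t) a ≤ √n * T.side t :=
      dist_le_of_mem_cubeQ (cubeCenter_mem _ _) ha
    linarith [dist_triangle (T.center t) a b]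
  have h4 := T.whitney₂ t
  rw [diam_cubeQ] at h4
  change _ ≤ 4 * (√n * T.side t) at h4
  linarith

lemma U_subset_ball (hn : 0 < n) (hf : (frontier Ω).Nonempty) (t : T.ι) :
    T.U t ⊆ ball (T.center t) (bdist Ω (T.center t)) := by
  intro x hx
  have hs := T.side_pos t
  have hd : dist x (T.center t) ≤ √n * (17 / 16 * (T.side t / 2)) :=
    dist_le_sqrt_mul (by positivity) fun i => (hx i).le
  have hsn : 0 < √(n:ℝ) := Real.sqrt_pos.2 (by exact_mod_cast hn)
  have := T.le_bdist_center hf t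
  rw [mem_ball]
  nlinarith [mul_pos hsn hs]

lemma U_subset (hΩ : IsOpen Ω) (hb : Bornology.IsBounded Ω) (t : T.ι) : T.U t ⊆ Ω := by
  rcases Nat.eq_zero_or_pos n with rfl | hn
  · intro x _
    rw [Subsingleton.elim x (T.center t)]
    exact T.center_mem t
  · have hf := frontier_nonempty_of_isBounded hn ⟨_, T.center_mem t⟩ hb
    exact (T.U_subset_ball hn hf t).trans (ball_infDist_frontier_subset hΩ (T.center_mem t))

/-- The reciprocals of a boundary log-Hölder exponent deviate from their average over `U_t` by
at most `L / |log |U_t||`, uniformly in `t`. -/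
lemma exists_forall_ae_abs_sub_avg_mul_abs_log_le (hΩo : IsOpen Ω) (hΩb : Bornology.IsBounded Ω)
    {p : Eucl n → ℝ} (hpm : Measurable p) (hp1 : ∀ x ∈ Ω, 1 ≤ p x)
    (hpb : ∃ M : ℝ, ∀ᵐ x ∂(volume.restrict Ω), p x ≤ M)
    {τ C₀ : ℝ} (hτ : 1 ≤ τ) (hC₀ : 0 < C₀) (hLH : BoundaryLH Ω p τ C₀) :
    ∃ L : ℝ, ∀ t : T.ι, ∀ᵐ x ∂(volume.restrict (T.U t)),
      |1 / p x - (volume (T.U t)).toReal⁻¹ * ∫ x in T.U t, 1 / p x|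
        * |Real.log (volume (T.U t)).toReal| ≤ L := by
  rcases Nat.eq_zero_or_pos n with rfl | hn
  · exact ⟨0, fun t => by simp [T.toReal_volume_U t]⟩
  have hf := frontier_nonempty_of_isBounded hn ⟨_, T.center_mem T.root⟩ hΩb
  have hsn : 1 ≤ √(n:ℝ) := Real.one_le_sqrt.2 (by exact_mod_cast hn)
  have hinv : Measurable fun x => 1 / p x := hpm.const_div 1
  set ℓ₀ : ℝ := 1 / (4 * (5 * τ * √n) ^ 2) with hℓ₀
  have hℓ₀pos : 0 < ℓ₀ := by positivity
  refine ⟨max (C₀ * (2 * n)) (max |Real.log ((17 / 16 * ℓ₀) ^ n)| |Real.log (volume Ω).toReal|),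
    fun t => ?_⟩
  have hℓ := T.side_pos t
  have hV : 0 < (volume (T.U t)).toReal := by rw [T.toReal_volume_U]; positivity
  have hUΩ := T.U_subset hΩo hΩb t
  have hUm : MeasurableSet (T.U t) := measurableSet_cubeU _ _
  rcases le_total (T.side t) ℓ₀ with hle | hge
  · set d := bdist Ω (T.center t) with hd
    have hdpos : 0 < d := lt_of_lt_of_le (by positivity) (T.le_bdist_center hf t)
    obtain ⟨hhalf, hlog⟩ := abs_log_pow_le_neg_log hn hτ hdpos hℓ (T.bdist_center_le hf t) hle
    have hLHt := hLH _ (T.center_mem t) hhalf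
    set D := ballB Ω τ (T.center t) ∩ Ω with hD
    have hUD : T.U t ⊆ D := subset_inter
      ((T.U_subset_ball hn hf t).trans (ball_subset_ball (le_mul_of_one_le_left hdpos.le hτ))) hUΩ
    have hDm : MeasurableSet D := measurableSet_ball.inter hΩo.measurableSet
    obtain ⟨M, hM⟩ := hpb
    have hpD : ∀ᵐ x ∂(volume.restrict D), 1 ≤ p x ∧ p x ≤ M :=
      ((ae_restrict_iff' hDm).2 (Eventually.of_forall fun x hx => hp1 x hx.2)).and
        (ae_restrict_of_ae_restrict_of_subset inter_subset_right hM)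
    have hbd := ae_restrict_of_ae_restrict_of_subset hUD (ae_mem_Icc_essInfOn_essSupOn hpD)
    set I := essInfOn p D
    set S := essSupOn p D
    have hneg : 0 < -Real.log (τ * d) := neg_pos.2 (Real.log_neg (by positivity) (by linarith))
    have hb : 0 ≤ C₀ / -Real.log (τ * d) := by positivity
    have hosc : max S 1 - max I 1 ≤ C₀ / -Real.log (τ * d) := by
      rcases le_total S 1 with h | h
      · rw [max_eq_right h]; linarith [le_max_right I 1]
      · rw [max_eq_left h]; linarith [le_max_left I 1]
    have hI1 : 1 ≤ max I 1 := le_max_right _ _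
    have hS1 : 1 ≤ max S 1 := le_max_right _ _
    have hrange : ∀ᵐ x ∂(volume.restrict (T.U t)),
        1 / max S 1 ≤ 1 / p x ∧ 1 / p x ≤ 1 / max I 1 := by
      filter_upwards [hbd, (ae_restrict_iff' hUm).2
        (Eventually.of_forall fun x hx => hp1 x (hUΩ hx))] with x hx h1
      exact ⟨one_div_le_one_div_of_le (by linarith) (hx.2.trans (le_max_left _ _)),
        one_div_le_one_div_of_le (by linarith) (max_le hx.1 h1)⟩
    have hdiff : 1 / max I 1 - 1 / max S 1 ≤ C₀ / -Real.log (τ * d) := by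
      have h1 : 1 / max I 1 - 1 / max S 1 = (max S 1 - max I 1) / (max I 1 * max S 1) := by
        field_simp
      rw [h1, div_le_iff₀ (by positivity)]
      have : 1 ≤ max I 1 * max S 1 := one_le_mul_of_one_le_of_one_le hI1 hS1
      nlinarith
    filter_upwards [ae_abs_sub_avg_le hinv hV hrange] with x hx
    refine le_max_of_le_left ?_
    rw [T.toReal_volume_U] at hx ⊢
    calc _ ≤ C₀ / -Real.log (τ * d) * (2 * n * -Real.log (τ * d)) :=
          mul_le_mul (hx.trans hdiff) hlog (abs_nonneg _) hb
      _ = C₀ * (2 * n) := by rw [mul_comm (2 * (n:ℝ)), ← mul_assoc, div_mul_cancel₀ _ hneg.ne']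
  · have hrange : ∀ᵐ x ∂(volume.restrict (T.U t)), 0 ≤ 1 / p x ∧ 1 / p x ≤ 1 := by
      refine (ae_restrict_iff' hUm).2 (Eventually.of_forall fun x hx => ?_)
      have h1 := hp1 x (hUΩ hx)
      exact ⟨by positivity, (div_le_one (by linarith)).2 h1⟩
    have hlog : |Real.log (volume (T.U t)).toReal|
        ≤ max |Real.log ((17 / 16 * ℓ₀) ^ n)| |Real.log (volume Ω).toReal| := by
      refine abs_log_le_of_mem_Icc (by positivity) ?_
        (ENNReal.toReal_mono hΩb.measure_lt_top.ne (measure_mono hUΩ))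
      rw [T.toReal_volume_U]
      gcongr
    filter_upwards [ae_abs_sub_avg_le hinv hV hrange] with x hx
    refine le_max_of_le_right ?_
    calc _ ≤ 1 * |Real.log (volume (T.U t)).toReal| := by
          gcongr; linarith
      _ ≤ _ := by rwa [one_mul]

end WhitneyTreeCovering

/-- Lemma 4.7, `‖χ_{U_t}‖_{p(·)} ≈ |U_t|^{1/p_{U_t}}`. -/
theorem norm_char_harmonic_mean
    (n : ℕ) (Ω : Set (Eucl n)) (hΩo : IsOpen Ω) (hΩc : IsConnected Ω)
    (hΩb : Bornology.IsBounded Ω) (T : WhitneyTreeCovering n Ω)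
    (p : Eucl n → ℝ) (hpm : Measurable p) (hp1 : ∀ x ∈ Ω, 1 ≤ p x)
    (hpb : ∃ M : ℝ, ∀ᵐ x ∂(volume.restrict Ω), p x ≤ M)
    (hpminus : 1 < essInfOn p Ω)
    (τ : ℝ) (hτ : 1 ≤ τ) (C₀ : ℝ) (hC₀ : 0 < C₀) (hLH : BoundaryLH Ω p τ C₀) :
    ∃ c C : ℝ, 0 < c ∧ ∀ t : T.ι,
      c * (volume (T.U t)).toReal
            ^ ((volume (T.U t)).toReal⁻¹ * ∫ x in T.U t, 1 / p x)
          ≤ luxNorm Ω p (charFun (T.U t)) ∧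
      luxNorm Ω p (charFun (T.U t))
          ≤ C * (volume (T.U t)).toReal
            ^ ((volume (T.U t)).toReal⁻¹ * ∫ x in T.U t, 1 / p x) := by
  obtain ⟨L, hL⟩ :=
    T.exists_forall_ae_abs_sub_avg_mul_abs_log_le hΩo hΩb hpm hp1 hpb hτ hC₀ hLH
  refine ⟨Real.exp (-L), Real.exp L, Real.exp_pos _, fun t => ?_⟩
  have hV : 0 < (volume (T.U t)).toReal := by
    have := T.side_pos t
    rw [T.toReal_volume_U]; positivity
  exact luxNorm_charFun_bounds hΩo.measurableSet (measurableSet_cubeU _ _)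
    (T.U_subset hΩo hΩb t) hp1 hV (hL t)
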